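/- arXiv:1303.4117 — 2 statements merged into one kernel-verified Lean document; each statement's English description precedes it below -/
import Mathlib

section
/- There exists q₀ such that for every odd prime power q ≥ q₀, the maximum value of f(r) over 0 ≤ r ≤ N equals (q² + 4q + 3)/4, and this maximum is attained exactly at the four values r = (q + 1)/2, r = (q + 3)/2, r = N − (q + 1)/2, and r = N − (q + 3)/2. -/
open scoped BigOperators

/-- Points (and, by self-duality of homogeneous coordinates, lines) of the
Desarguesian projective plane `PG(2,q)` over the field `F`. -/
abbrev PG (F : Type*) [Field F] := Projectivization F (Fin 3 → F)

/-- Incidence between a point and a line (the line being given by its dual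
homogeneous coordinates): the dot product of representatives vanishes.
This does not depend on the choice of representatives. -/
def Incid {F : Type*} [Field F] (p l : PG F) : Prop :=
  ∑ i, p.rep i * l.rep i = 0

/-- `𝒫ᵒ(R)`: points incident with an odd number of lines of `R`. -/
def Podd (F : Type*) [Field F] (R : Set (PG F)) : Set (PG F) :=
  {p | Odd {l ∈ R | Incid p l}.ncard}

/-- `𝒫ᵉ(R)`: points incident with an even number of lines of `R`. -/
def Peven (F : Type*) [Field F] (R : Set (PG F)) : Set (PG F) :=
  {p | Even {l ∈ R | Incid p l}.ncard}

/-- `ℒᵒ(S)`: lines meeting `S` in an odd number of points. -/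
def Lodd (F : Type*) [Field F] (S : Set (PG F)) : Set (PG F) :=
  {l | Odd {p ∈ S | Incid p l}.ncard}

/-- `ℒᵉ(S)`: lines meeting `S` in an even number of points. -/
def Leven (F : Type*) [Field F] (S : Set (PG F)) : Set (PG F) :=
  {l | Even {p ∈ S | Incid p l}.ncard}

/-- `f(r)`: the minimum size of the symmetric difference of `r` distinct lines,
i.e. the minimum of `|𝒫ᵒ(R)|` over sets `R` of exactly `r` lines. -/
noncomputable def fmin (F : Type*) [Field F] (r : ℕ) : ℕ :=
  sInf {n | ∃ R : Set (PG F), R.ncard = r ∧ (Podd F R).ncard = n}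

section helpers

set_option linter.unusedSectionVars false

open Projectivization Finset
open scoped Classical

variable {F : Type} [Field F] [Fintype F]

noncomputable local instance instFintypePG : Fintype (PG F) := Fintype.ofFinite _

theorem incid_iff (p l : PG F) : Incid p l ↔ orthogonal p l := by
  conv_rhs => rw [← p.mk_rep, ← l.mk_rep]
  rw [orthogonal_mk]
  rfl

theorem incid_mk {v w : Fin 3 → F} (hv : v ≠ 0) (hw : w ≠ 0) :
    Incid (mk F v hv) (mk F w hw) ↔ v 0 * w 0 + v 1 * w 1 + v 2 * w 2 = 0 := by
  rw [incid_iff, orthogonal_mk, dotProduct, Fin.sum_univ_three]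

/-- degree of a point -/
noncomputable def dg (R : Finset (PG F)) (p : PG F) : ℕ := (R.filter (fun l => Incid p l)).card

/-- the odd points -/
noncomputable def od (R : Finset (PG F)) : Finset (PG F) := univ.filter (fun p => Odd (dg R p))

theorem podd_coe (R : Finset (PG F)) : Podd F (R : Set (PG F)) = (od R : Set (PG F)) := by
  ext p
  have h : {l ∈ (R : Set (PG F)) | Incid p l} = ((R.filter (fun l => Incid p l) : Finset (PG F)) : Set (PG F)) := by
    ext l; simp
  have h2 : p ∈ Podd F (R : Set (PG F)) ↔ Odd {l ∈ (R : Set (PG F)) | Incid p l}.ncard := Iff.rfl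
  rw [h2, h, Set.ncard_coe_finset, Finset.mem_coe, od, Finset.mem_filter]
  simp [dg]

theorem fmin_le (R : Finset (PG F)) : fmin F R.card ≤ (od R).card := by
  apply Nat.sInf_le
  exact ⟨R, Set.ncard_coe_finset R, by rw [podd_coe, Set.ncard_coe_finset]⟩

theorem fmin_attained (r : ℕ) (hr : r ≤ Fintype.card (PG F)) :
    ∃ R : Finset (PG F), R.card = r ∧ (od R).card = fmin F r := by
  have hne : {n | ∃ R : Set (PG F), R.ncard = r ∧ (Podd F R).ncard = n}.Nonempty := by
    obtain ⟨R, -, hR⟩ := Finset.exists_subset_card_eq (s := (univ : Finset (PG F))) (n := r)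
      (by simpa using hr)
    exact ⟨_, R, by rw [Set.ncard_coe_finset, hR], rfl⟩
  obtain ⟨R, h1, h2⟩ := Nat.sInf_mem hne
  refine ⟨R.toFinset, ?_, ?_⟩
  · rw [← h1, Set.ncard_eq_toFinset_card']
  · rw [fmin, ← h2, ← Set.ncard_coe_finset, ← podd_coe, Set.coe_toFinset]

theorem plane_order : Configuration.ProjectivePlane.order (PG F) (PG F) = Fintype.card F := by
  have h1 := Configuration.ProjectivePlane.card_points (PG F) (PG F)
  have h2 := Projectivization.card_of_finrank F (Fin 3 → F) (n := 3) (by simp)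
  rw [Nat.card_eq_fintype_card, Nat.card_eq_fintype_card, h1] at h2
  simp only [Finset.sum_range_succ, Finset.sum_range_zero] at h2
  generalize Configuration.ProjectivePlane.order (PG F) (PG F) = a at *
  generalize Fintype.card F = b at *
  rcases lt_trichotomy a b with h | h | h
  · nlinarith
  · exact h
  · nlinarith

theorem card_pg : Fintype.card (PG F) = Fintype.card F ^ 2 + Fintype.card F + 1 := by
  rw [Configuration.ProjectivePlane.card_points (PG F) (PG F), plane_order]

theorem card_points_on (l : PG F) : (univ.filter (fun p => Incid p l)).card = Fintype.card F + 1 := by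
  have h := Configuration.ProjectivePlane.pointCount_eq (PG F) (L := PG F) l
  rw [plane_order, Configuration.pointCount, Nat.card_eq_fintype_card, Fintype.card_subtype] at h
  rw [← h]
  congr 1
  ext p
  simp [incid_iff, Configuration.ofField.mem_iff]

theorem card_lines_on (p : PG F) : (univ.filter (fun l => Incid p l)).card = Fintype.card F + 1 := by
  rw [← card_points_on p]
  congr 1
  ext l
  simp [incid_iff, orthogonal_comm]

theorem card_inter {a b : PG F} (hab : a ≠ b) :
    (univ.filter (fun p => Incid p a ∧ Incid p b)).card = 1 := by
  rw [Finset.card_eq_one]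
  refine ⟨cross a b, ?_⟩
  ext p
  simp only [mem_filter, mem_univ, true_and, mem_singleton, incid_iff]
  constructor
  · rintro ⟨h1, h2⟩
    rcases Configuration.ofField.eq_or_eq_of_orthogonal h1 (cross_orthogonal_left hab) h2
      (cross_orthogonal_right hab) with h | h
    · exact h
    · exact absurd h hab
  · rintro rfl
    exact ⟨cross_orthogonal_left hab, cross_orthogonal_right hab⟩

theorem card_join {a b : PG F} (hab : a ≠ b) :
    (univ.filter (fun l => Incid a l ∧ Incid b l)).card = 1 := by
  rw [← card_inter hab]
  congr 1
  ext l
  simp [incid_iff, orthogonal_comm]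

theorem incid_unique {a b c d : PG F} (h1 : Incid a c) (h2 : Incid b c) (h3 : Incid a d)
    (h4 : Incid b d) : a = b ∨ c = d := by
  rw [incid_iff] at *
  exact Configuration.ofField.eq_or_eq_of_orthogonal h1 h2 h3 h4

theorem dg_eq_sum (R : Finset (PG F)) (p : PG F) :
    dg R p = ∑ l ∈ R, if Incid p l then 1 else 0 := by
  rw [dg, Finset.card_filter]

theorem sum_dg (R : Finset (PG F)) : ∑ p, dg R p = R.card * (Fintype.card F + 1) := by
  simp_rw [dg_eq_sum]
  rw [Finset.sum_comm]
  simp_rw [← Finset.card_filter, card_points_on]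
  simp

theorem sum_dg_mul (A B : Finset (PG F)) :
    ∑ p, dg A p * dg B p = A.card * B.card + Fintype.card F * (A ∩ B).card := by
  have h : ∀ p, dg A p * dg B p
      = ∑ a ∈ A, ∑ b ∈ B, if Incid p a ∧ Incid p b then 1 else 0 := by
    intro p
    rw [dg_eq_sum, dg_eq_sum, Finset.sum_mul_sum]
    refine Finset.sum_congr rfl fun a _ => Finset.sum_congr rfl fun b _ => ?_
    by_cases h1 : Incid p a <;> by_cases h2 : Incid p b <;> simp [h1, h2]
  simp_rw [h]
  rw [Finset.sum_comm]
  have h2 : ∀ a ∈ A, ∑ p, ∑ b ∈ B, (if Incid p a ∧ Incid p b then 1 else 0)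
      = B.card + Fintype.card F * (if a ∈ B then 1 else 0) := by
    intro a _
    rw [Finset.sum_comm]
    have h3 : ∀ b ∈ B, ∑ p, (if Incid p a ∧ Incid p b then 1 else 0)
        = 1 + Fintype.card F * (if a = b then 1 else 0) := by
      intro b _
      rw [← Finset.card_filter]
      by_cases hab : a = b
      · subst hab
        simp [card_points_on, add_comm]
      · rw [card_inter hab]; simp [hab]
    rw [Finset.sum_congr rfl h3, Finset.sum_add_distrib, ← Finset.mul_sum]
    simp
  rw [Finset.sum_congr rfl h2, Finset.sum_add_distrib, ← Finset.mul_sum, ← Finset.card_filter,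
    Finset.filter_mem_eq_inter]
  simp

theorem card_od (R : Finset (PG F)) : (od R).card = ∑ p, if Odd (dg R p) then 1 else 0 := by
  rw [od, Finset.card_filter]

theorem odd_lower (d : ℕ) : (d : ℤ) * (2 - d) ≤ ((if Odd d then 1 else 0 : ℕ) : ℤ) := by
  split_ifs with h
  · push_cast
    nlinarith [sq_nonneg ((d : ℤ) - 1)]
  · rcases Nat.lt_or_ge d 2 with h2 | h2
    · interval_cases d
      · simp
      · simp at h
    · push_cast
      nlinarith [(by exact_mod_cast h2 : (2 : ℤ) ≤ d)]

theorem od_lower (R : Finset (PG F)) :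
    (R.card : ℤ) * (Fintype.card F + 2 - R.card) ≤ ((od R).card : ℤ) := by
  have h1 := sum_dg R
  have h2 := sum_dg_mul R R
  rw [Finset.inter_self] at h2
  have h3 : ∑ p, ((dg R p : ℤ) * (2 - dg R p)) ≤ ((od R).card : ℤ) := by
    rw [card_od, Nat.cast_sum]
    exact Finset.sum_le_sum fun p _ => odd_lower _
  have h4 : ∑ p, ((dg R p : ℤ) * (2 - dg R p))
      = 2 * ((∑ p, dg R p : ℕ) : ℤ) - ((∑ p, dg R p * dg R p : ℕ) : ℤ) := by
    push_cast
    rw [Finset.mul_sum, ← Finset.sum_sub_distrib]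
    exact Finset.sum_congr rfl fun p _ => by ring
  rw [h4, h1, h2] at h3
  push_cast at h3
  linarith

theorem od_arc (R : Finset (PG F)) (h : ∀ p, dg R p ≤ 2) :
    ((od R).card : ℤ) = (R.card : ℤ) * (Fintype.card F + 2 - R.card) := by
  have h1 := sum_dg R
  have h2 := sum_dg_mul R R
  rw [Finset.inter_self] at h2
  have h3 : ∑ p, ((dg R p : ℤ) * (2 - dg R p)) = ((od R).card : ℤ) := by
    rw [card_od, Nat.cast_sum]
    refine Finset.sum_congr rfl fun p _ => ?_
    have := h p
    generalize dg R p = d at *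
    interval_cases d <;> simp
  have h4 : ∑ p, ((dg R p : ℤ) * (2 - dg R p))
      = 2 * ((∑ p, dg R p : ℕ) : ℤ) - ((∑ p, dg R p * dg R p : ℕ) : ℤ) := by
    push_cast
    rw [Finset.mul_sum, ← Finset.sum_sub_distrib]
    exact Finset.sum_congr rfl fun p _ => by ring
  rw [h4, h1, h2] at h3
  push_cast at h3
  linarith

theorem dg_union {A B : Finset (PG F)} (h : Disjoint A B) (p : PG F) :
    dg (A ∪ B) p = dg A p + dg B p := by
  rw [dg_eq_sum, dg_eq_sum, dg_eq_sum, Finset.sum_union h]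

theorem dg_sdiff {A B : Finset (PG F)} (h : B ⊆ A) (p : PG F) :
    dg (A \ B) p + dg B p = dg A p := by
  rw [dg_eq_sum, dg_eq_sum, dg_eq_sum, Finset.sum_sdiff h]

theorem dg_mono {A B : Finset (PG F)} (h : A ⊆ B) (p : PG F) : dg A p ≤ dg B p :=
  Finset.card_le_card (Finset.filter_subset_filter _ h)

theorem od_union {A B : Finset (PG F)} (h : Disjoint A B) :
    (od (A ∪ B)).card ≤ (od A).card + (od B).card := by
  refine le_trans (Finset.card_le_card ?_) (Finset.card_union_le _ _)
  intro p
  simp only [od, mem_filter, mem_univ, true_and, mem_union, dg_union h]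
  grind

theorem od_sdiff {A B : Finset (PG F)} (h : B ⊆ A) :
    (od (A \ B)).card ≤ (od A).card + (od B).card := by
  refine le_trans (Finset.card_le_card ?_) (Finset.card_union_le _ _)
  intro p
  have := dg_sdiff h p
  simp only [od, mem_filter, mem_univ, true_and, mem_union]
  grind

theorem od_compl (hq : Odd (Fintype.card F)) (R : Finset (PG F)) : od Rᶜ = od R := by
  ext p
  have h := dg_sdiff (Finset.subset_univ R) p
  have h2 : dg univ p = Fintype.card F + 1 := card_lines_on p
  rw [← Finset.compl_eq_univ_sdiff] at h
  simp only [od, mem_filter, mem_univ, true_and]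
  grind

/-- Selection of `k` lines with a saving. -/
theorem exists_saving (M : Finset (PG F)) (X : PG F) (k j : ℕ) (hk : k ≤ dg M X) (hjk : j ≤ k)
    (hM : Fintype.card F + 1 + j ≤ M.card) :
    ∃ K ⊆ M, K.card = k ∧ (od K).card + j * (k - j) ≤ k * (Fintype.card F + 1) := by
  obtain ⟨K1, hK1, hc1⟩ := Finset.exists_subset_card_eq (s := M.filter (fun l => Incid X l))
    (n := k - j) (by unfold dg at hk; omega)
  have hle : (M.filter (fun l => Incid X l)).card ≤ Fintype.card F + 1 := by
    rw [← card_lines_on X]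
    exact Finset.card_le_card (Finset.filter_subset_filter _ (Finset.subset_univ M))
  have hsp := Finset.card_filter_add_card_filter_not (s := M) (fun l => Incid X l)
  obtain ⟨K2, hK2, hc2⟩ := Finset.exists_subset_card_eq (s := M.filter (fun l => ¬ Incid X l))
    (n := j) (by omega)
  have hdisj : Disjoint K1 K2 :=
    Finset.disjoint_of_subset_left hK1 (Finset.disjoint_of_subset_right hK2
      (Finset.disjoint_filter_filter_not _ _ _))
  have hcard : (K1 ∪ K2).card = k := by
    rw [Finset.card_union_of_disjoint hdisj, hc1, hc2]; omega
  refine ⟨K1 ∪ K2, ?_, hcard, ?_⟩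
  · exact Finset.union_subset (hK1.trans (Finset.filter_subset _ _))
      (hK2.trans (Finset.filter_subset _ _))
  · have h1 := sum_dg (K1 ∪ K2)
    have h2 := sum_dg_mul K1 K2
    rw [Finset.disjoint_iff_inter_eq_empty.mp hdisj, hc1, hc2] at h2
    simp only [Finset.card_empty, mul_zero, add_zero] at h2
    rw [hcard] at h1
    rw [← h1, mul_comm j, ← h2, card_od, ← Finset.sum_add_distrib]
    refine Finset.sum_le_sum fun p _ => ?_
    rw [dg_union hdisj]
    by_cases hp : p = X
    · have : dg K2 p = 0 := by
        rw [dg, Finset.card_eq_zero, Finset.filter_eq_empty_iff]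
        intro l hl
        rw [hp]
        exact (Finset.mem_filter.mp (hK2 hl)).2
      rw [this]
      simp only [add_zero, mul_zero]
      split_ifs with h
      · exact h.pos
      · exact Nat.zero_le _
    · have : dg K1 p ≤ 1 := by
        rw [dg, Finset.card_le_one]
        intro a ha b hb
        simp only [mem_filter] at ha hb
        have ha' := (Finset.mem_filter.mp (hK1 ha.1)).2
        have hb' := (Finset.mem_filter.mp (hK1 hb.1)).2
        rcases incid_unique ha.2 ha' hb.2 hb' with h | h
        · exact absurd h hp
        · exact h
      generalize dg K1 p = d at *
      interval_cases d
      · split_ifs with h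
        · have := h.pos; omega
        · omega
      · split_ifs with h <;> omega

theorem exists_rich (M : Finset (PG F)) (k : ℕ)
    (h : Fintype.card (PG F) * k < M.card * (Fintype.card F + 1)) : ∃ X, k ≤ dg M X := by
  by_contra! hc
  have h1 := sum_dg M
  have h2 : ∑ p, dg M p ≤ ∑ _p : PG F, k := Finset.sum_le_sum fun p _ => (hc p).le
  simp at h2
  have : Fintype.card (PG F) * k = (univ : Finset (PG F)).card * k := rfl
  simp at this
  omega

/-- lines other than `l` through a point of `A` -/
noncomputable def pen (l : PG F) (A : Finset (PG F)) : Finset (PG F) :=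
  A.biUnion (fun a => univ.filter (fun m => Incid a m ∧ m ≠ l))

theorem mem_pen {l m : PG F} {A : Finset (PG F)} :
    m ∈ pen l A ↔ ∃ a ∈ A, Incid a m ∧ m ≠ l := by
  simp [pen]

theorem pen_single_card {l a : PG F} (h : Incid a l) :
    (univ.filter (fun m => Incid a m ∧ m ≠ l)).card = Fintype.card F := by
  have h1 := card_lines_on a
  have h2 : univ.filter (fun m => Incid a m ∧ m ≠ l)
      = (univ.filter (fun m => Incid a m)).erase l := by
    ext m; simp [and_comm]
  rw [h2, Finset.card_erase_of_mem (by simpa using h), h1]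
  simp

theorem pen_disj {l : PG F} {A : Finset (PG F)} (hA : ∀ a ∈ A, Incid a l) :
    (A : Set (PG F)).PairwiseDisjoint (fun a => univ.filter (fun m => Incid a m ∧ m ≠ l)) := by
  intro a ha b hb hab
  rw [Function.onFun, Finset.disjoint_left]
  intro m hm hm'
  simp only [mem_filter, mem_univ, true_and] at hm hm'
  rcases incid_unique hm.1 hm'.1 (hA a ha) (hA b hb) with h | h
  · exact hab h
  · exact hm.2 h

theorem card_pen {l : PG F} {A : Finset (PG F)} (hA : ∀ a ∈ A, Incid a l) :
    (pen l A).card = A.card * Fintype.card F := by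
  rw [pen, Finset.card_biUnion (pen_disj hA), Finset.sum_congr rfl
    (fun a ha => pen_single_card (hA a ha))]
  simp

theorem dg_pen {l : PG F} {A : Finset (PG F)} (hA : ∀ a ∈ A, Incid a l) {p : PG F}
    (hp : ¬ Incid p l) : dg (pen l A) p = A.card := by
  rw [dg, pen, Finset.filter_biUnion, Finset.card_biUnion]
  · have : ∀ a ∈ A, ((univ.filter (fun m => Incid a m ∧ m ≠ l)).filter
        (fun m => Incid p m)).card = 1 := by
      intro a ha
      have hap : a ≠ p := by
        rintro rfl; exact hp (hA a ha)
      rw [← card_join hap]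
      congr 1
      ext m
      simp only [mem_filter, mem_univ, true_and]
      constructor
      · rintro ⟨⟨h1, h2⟩, h3⟩; exact ⟨h1, h3⟩
      · rintro ⟨h1, h3⟩
        refine ⟨⟨h1, ?_⟩, h3⟩
        rintro rfl; exact hp h3
    rw [Finset.sum_congr rfl this]
    simp
  · intro a ha b hb hab
    exact Finset.disjoint_of_subset_left (Finset.filter_subset _ _)
      (Finset.disjoint_of_subset_right (Finset.filter_subset _ _) (pen_disj hA ha hb hab))

theorem dg_pen_mem {l a : PG F} {A : Finset (PG F)} (hA : ∀ a ∈ A, Incid a l) (ha : a ∈ A) :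
    Fintype.card F ≤ dg (pen l A) a := by
  rw [← pen_single_card (hA a ha), dg]
  apply Finset.card_le_card
  intro m hm
  simp only [mem_filter, mem_univ, true_and] at hm
  simp only [mem_filter]
  exact ⟨mem_pen.mpr ⟨a, ha, hm⟩, hm.1⟩

theorem od_pen {l : PG F} {A : Finset (PG F)} (hA : ∀ a ∈ A, Incid a l) (he : Even A.card) :
    (od (pen l A)).card ≤ Fintype.card F + 1 := by
  rw [← card_points_on l]
  apply Finset.card_le_card
  intro p hp
  simp only [od, mem_filter, mem_univ, true_and] at hp ⊢
  by_contra hc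
  rw [dg_pen hA hc] at hp
  exact (Nat.not_odd_iff_even.mpr he) hp

/-- point or line from coordinates -/
noncomputable def pt (a b c : F) : PG F :=
  if h : (![a, b, c] : Fin 3 → F) ≠ 0 then mk F ![a, b, c] h else mk F ![1, 0, 0] (by simp)

theorem vec_ne {a b c : F} (h : a ≠ 0 ∨ b ≠ 0 ∨ c ≠ 0) : (![a, b, c] : Fin 3 → F) ≠ 0 := by
  intro hc
  have h0 := congrFun hc 0
  have h1 := congrFun hc 1
  have h2 := congrFun hc 2
  simp at h0 h1 h2
  tauto

theorem incid_pt {a b c x y z : F} (h : a ≠ 0 ∨ b ≠ 0 ∨ c ≠ 0) (h' : x ≠ 0 ∨ y ≠ 0 ∨ z ≠ 0) :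
    Incid (pt x y z) (pt a b c) ↔ x * a + y * b + z * c = 0 := by
  rw [pt, pt, dif_pos (vec_ne h), dif_pos (vec_ne h'), incid_mk]
  simp

theorem exists_pt (p : PG F) : ∃ x y z : F, (x ≠ 0 ∨ y ≠ 0 ∨ z ≠ 0) ∧ p = pt x y z := by
  have hne : (![p.rep 0, p.rep 1, p.rep 2] : Fin 3 → F) = p.rep := by
    ext i; fin_cases i <;> rfl
  have h0 := p.rep_nonzero
  refine ⟨p.rep 0, p.rep 1, p.rep 2, ?_, ?_⟩
  · by_contra! hc
    apply h0
    rw [← hne, hc.1, hc.2.1, hc.2.2]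
    ext i; fin_cases i <;> rfl
  · rw [pt, dif_pos (by rw [hne]; exact h0)]
    conv_lhs => rw [← p.mk_rep]
    congr 1
    exact hne.symm

theorem pt_eq {a b c x y z : F} (h : a ≠ 0 ∨ b ≠ 0 ∨ c ≠ 0) (h' : x ≠ 0 ∨ y ≠ 0 ∨ z ≠ 0)
    (he : pt a b c = pt x y z) : ∃ u : F, u * x = a ∧ u * y = b ∧ u * z = c := by
  rw [pt, pt, dif_pos (vec_ne h), dif_pos (vec_ne h'), mk_eq_mk_iff'] at he
  obtain ⟨u, hu⟩ := he
  refine ⟨u, ?_, ?_, ?_⟩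
  · simpa using congrFun hu 0
  · simpa using congrFun hu 1
  · simpa using congrFun hu 2

/-- elements with given quadratic character -/
noncomputable def qs (F : Type) [Field F] [Fintype F] (e : ℤ) : Finset F :=
  univ.filter (fun t => quadraticChar F t = e)

theorem mem_qs {e : ℤ} {t : F} : t ∈ qs F e ↔ quadraticChar F t = e := by simp [qs]

theorem qs_ne {e : ℤ} (he : e = 1 ∨ e = -1) {t : F} (h : t ∈ qs F e) : t ≠ 0 := by
  rintro rfl
  rw [mem_qs] at h
  simp at h
  rcases he with rfl | rfl <;> simp at h

theorem ringChar_ne (hq : Odd (Fintype.card F)) : ringChar F ≠ 2 := by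
  intro h
  have := FiniteField.even_card_of_char_two h
  rw [Nat.odd_iff] at hq
  omega

theorem card_qs (hq : Odd (Fintype.card F)) {e : ℤ} (he : e = 1 ∨ e = -1) :
    2 * (qs F e).card + 1 = Fintype.card F := by
  have h1 := quadraticChar_sum_zero (ringChar_ne hq)
  have h2 : ∀ t : F, quadraticChar F t
      = (if quadraticChar F t = 1 then 1 else 0) - (if quadraticChar F t = -1 then 1 else 0) := by
    intro t
    by_cases ht : t = 0
    · simp [ht]
    · rcases quadraticChar_dichotomy ht with h | h <;> simp [h]
  have h3 : ∀ t : F, (1 : ℤ)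
      = (if quadraticChar F t = 1 then 1 else 0) + (if quadraticChar F t = -1 then 1 else 0)
        + (if t = 0 then 1 else 0) := by
    intro t
    by_cases ht : t = 0
    · simp [ht]
    · rcases quadraticChar_dichotomy ht with h | h <;> simp [h, ht]
  have h4 : (Fintype.card F : ℤ) = ∑ t : F, (1 : ℤ) := by simp
  rw [Finset.sum_congr rfl (fun t _ => h3 t), Finset.sum_add_distrib, Finset.sum_add_distrib] at h4
  rw [Finset.sum_congr rfl (fun t _ => h2 t), Finset.sum_sub_distrib] at h1
  have hA : ((qs F 1).card : ℤ) = ∑ t : F, (if quadraticChar F t = 1 then 1 else 0) := by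
    rw [qs]; simp
  have hB : ((qs F (-1)).card : ℤ) = ∑ t : F, (if quadraticChar F t = -1 then 1 else 0) := by
    rw [qs]; simp
  have hC : ∑ t : F, (if t = 0 then (1 : ℤ) else 0) = 1 := by simp
  rw [← hA, ← hB] at h1 h4
  rw [hC] at h4
  rcases he with rfl | rfl <;> omega

/-- the dual conic -/
noncomputable def con (F : Type) [Field F] [Fintype F] : Finset (PG F) :=
  insert (pt 0 0 1) (univ.image (fun t : F => pt 1 t (t ^ 2)))

theorem card_con : (con F).card = Fintype.card F + 1 := by
  rw [con, Finset.card_insert_of_notMem, Finset.card_image_of_injective]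
  · simp
  · intro s t h
    obtain ⟨u, h1, h2, -⟩ := pt_eq (by simp) (by simp) h
    simp only [mul_one] at h1
    rw [h1, one_mul] at h2
    exact h2.symm
  · simp only [mem_image, mem_univ, true_and, not_exists]
    intro t h
    obtain ⟨u, h1, -, -⟩ := pt_eq (by simp) (by simp) h
    simp at h1

theorem dg_con (p : PG F) : dg (con F) p ≤ 2 := by
  obtain ⟨x, y, z, hne, rfl⟩ := exists_pt p
  rw [dg, con, Finset.filter_insert]
  have himg : ((univ.image (fun t : F => pt 1 t (t ^ 2))).filter
      (fun l => Incid (pt x y z) l)).card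
      ≤ (univ.filter (fun t : F => x + y * t + z * t ^ 2 = 0)).card := by
    rw [Finset.filter_image]
    refine le_trans Finset.card_image_le (Finset.card_le_card ?_)
    intro t
    simp only [mem_filter, mem_univ, true_and]
    rw [incid_pt (by simp) hne]
    simp
  rw [incid_pt (by simp) hne]
  by_cases hz : z = 0
  · rw [if_pos (by simp [hz])]
    refine le_trans (Finset.card_insert_le _ _) ?_
    have : (univ.filter (fun t : F => x + y * t + z * t ^ 2 = 0)).card ≤ 1 := by
      rw [Finset.card_le_one]
      intro a ha b hb
      simp only [mem_filter, mem_univ, true_and, hz, zero_mul, add_zero] at ha hb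
      have hy : y ≠ 0 := by
        rintro rfl
        simp at ha
        simp [ha, hz] at hne
      apply mul_left_cancel₀ hy
      linear_combination ha - hb
    omega
  · rw [if_neg (by simpa using hz)]
    refine le_trans himg ?_
    by_contra! hc
    rw [Finset.two_lt_card] at hc
    obtain ⟨a, ha, b, hb, c, hc, hab, hac, hbc⟩ := hc
    simp only [mem_filter, mem_univ, true_and] at ha hb hc
    have h1 : (a - b) * (y + z * (a + b)) = 0 := by linear_combination ha - hb
    have h2 : (a - c) * (y + z * (a + c)) = 0 := by linear_combination ha - hc
    have h1' := (mul_eq_zero.mp h1).resolve_left (sub_ne_zero.mpr hab)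
    have h2' := (mul_eq_zero.mp h2).resolve_left (sub_ne_zero.mpr hac)
    have h3 : z * (b - c) = 0 := by linear_combination h1' - h2'
    rcases mul_eq_zero.mp h3 with h | h
    · exact hz h
    · exact hbc (sub_eq_zero.mp h)

theorem od_con_sub {K : Finset (PG F)} (hK : K ⊆ con F) :
    ((od K).card : ℤ) = (K.card : ℤ) * (Fintype.card F + 2 - K.card) :=
  od_arc K fun p => (dg_mono hK p).trans (dg_con p)

theorem od_con : (od (con F)).card = Fintype.card F + 1 := by
  have := od_con_sub (Finset.Subset.refl (con F))
  rw [card_con] at this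
  push_cast at this
  have h2 : ((Fintype.card F : ℤ) + 1) * (Fintype.card F + 2 - (Fintype.card F + 1))
    = Fintype.card F + 1 := by ring
  rw [h2] at this
  exact_mod_cast this

/-- family E -/
theorem famE (s : ℕ) (hs : s ≤ Fintype.card F + 1) (he : Even s) (h2 : 2 ≤ s) :
    ∃ R : Finset (PG F), R.card = s * Fintype.card F ∧ (od R).card ≤ 3 * (Fintype.card F + 1) ∧
      ∃ X, Fintype.card F ≤ dg R X := by
  obtain ⟨A, hA, hc⟩ := Finset.exists_subset_card_eq
    (s := (univ.filter (fun p : PG F => Incid p (pt 1 0 0)))) (n := s)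
    (by rw [card_points_on]; exact hs)
  have hA' : ∀ a ∈ A, Incid a (pt 1 0 0) := fun a ha => (Finset.mem_filter.mp (hA ha)).2
  refine ⟨pen (pt 1 0 0) A, by rw [card_pen hA', hc], ?_, ?_⟩
  · have := od_pen hA' (hc ▸ he)
    omega
  · obtain ⟨a, ha⟩ := Finset.card_pos.mp (by omega : 0 < A.card)
    exact ⟨a, dg_pen_mem hA' ha⟩

/-- family C -/
theorem famC (hq : Odd (Fintype.card F)) (s : ℕ) (hs : 2 * s + 1 ≤ Fintype.card F) (he : Even s) :
    ∃ R : Finset (PG F), R.card = s * Fintype.card F + (Fintype.card F + 1) ∧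
      (od R).card ≤ 3 * (Fintype.card F + 1) ∧
      (2 ≤ s → ∃ X, Fintype.card F ≤ dg R X) := by
  obtain ⟨B, hB, hc⟩ := Finset.exists_subset_card_eq (s := qs F (-1)) (n := s)
    (by have := card_qs hq (e := -1) (by simp); omega)
  set A : Finset (PG F) := B.image (fun u => pt u 0 (-1)) with hAdef
  have hcA : A.card = s := by
    rw [hAdef, Finset.card_image_of_injective, hc]
    intro u v h
    obtain ⟨w, h1, -, h2⟩ := pt_eq (by simp) (by simp) h
    have : w = 1 := by linear_combination -h2
    rw [this, one_mul] at h1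
    exact h1.symm
  have hA' : ∀ a ∈ A, Incid a (pt 0 1 0) := by
    intro a ha
    obtain ⟨u, -, rfl⟩ := Finset.mem_image.mp ha
    rw [incid_pt (by simp) (by simp)]
    simp
  have hdisj : Disjoint (pen (pt 0 1 0) A) (con F) := by
    rw [Finset.disjoint_left]
    intro m hm hm'
    obtain ⟨a, ha, hin, -⟩ := mem_pen.mp hm
    obtain ⟨u, hu, rfl⟩ := Finset.mem_image.mp ha
    have hu' := mem_qs.mp (hB hu)
    rw [con, Finset.mem_insert, Finset.mem_image] at hm'
    rcases hm' with rfl | ⟨t, -, rfl⟩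
    · rw [incid_pt (by simp) (by simp)] at hin
      simp at hin
    · rw [incid_pt (by simp) (by simp)] at hin
      rw [quadraticChar_neg_one_iff_not_isSquare] at hu'
      apply hu'
      exact ⟨t, by linear_combination hin⟩
  refine ⟨pen (pt 0 1 0) A ∪ con F, ?_, ?_, ?_⟩
  · rw [Finset.card_union_of_disjoint hdisj, card_pen hA', hcA, card_con]
  · have h1 := od_union hdisj
    have h2 := od_pen hA' (hcA ▸ he)
    rw [od_con] at h1
    omega
  · intro h2
    obtain ⟨a, ha⟩ := Finset.card_pos.mp (by omega : 0 < A.card)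
    exact ⟨a, (dg_pen_mem hA' ha).trans (dg_mono Finset.subset_union_left _)⟩

/-- the three half pencils -/
noncomputable def T1 (F : Type) [Field F] [Fintype F] (e : ℤ) : Finset (PG F) :=
  (qs F e).image (fun c => pt 0 1 (-c))
noncomputable def T2 (F : Type) [Field F] [Fintype F] (e : ℤ) : Finset (PG F) :=
  (qs F e).image (fun c => pt (-c) 0 1)
noncomputable def T3 (F : Type) [Field F] [Fintype F] (e : ℤ) : Finset (PG F) :=
  (qs F e).image (fun c => pt 1 (-c) 0)

theorem card_T1 (e : ℤ) : (T1 F e).card = (qs F e).card := by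
  apply Finset.card_image_of_injective
  intro u v h
  obtain ⟨w, -, h1, h2⟩ := pt_eq (by simp) (by simp) h
  have h3 : w = 1 := by simpa using h1
  rw [h3] at h2
  simpa using h2.symm

theorem card_T2 (e : ℤ) : (T2 F e).card = (qs F e).card := by
  apply Finset.card_image_of_injective
  intro u v h
  obtain ⟨w, h2, -, h1⟩ := pt_eq (by simp) (by simp) h
  have h3 : w = 1 := by simpa using h1
  rw [h3] at h2
  simpa using h2.symm

theorem card_T3 (e : ℤ) : (T3 F e).card = (qs F e).card := by
  apply Finset.card_image_of_injective
  intro u v h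
  obtain ⟨w, h1, h2, -⟩ := pt_eq (by simp) (by simp) h
  have h3 : w = 1 := by simpa using h1
  rw [h3] at h2
  simpa using h2.symm

theorem card_filter_single (e : ℤ) (P : F → Prop) (c : F) (hP : ∀ t, P t ↔ t = c) :
    ((qs F e).filter P).card = if quadraticChar F c = e then 1 else 0 := by
  have : (qs F e).filter P = if quadraticChar F c = e then {c} else ∅ := by
    ext t
    simp only [mem_filter, mem_qs, hP]
    split_ifs with h
    · simp only [mem_singleton]
      constructor
      · exact fun h => h.2
      · rintro rfl; exact ⟨h, rfl⟩
    · simp only [notMem_empty, iff_false]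
      rintro ⟨h1, rfl⟩; exact h h1
  rw [this]
  split_ifs <;> simp

theorem dg_image (s : Finset F) (f : F → PG F) (hf : (s.image f).card = s.card) (p : PG F) :
    dg (s.image f) p = (s.filter (fun t => Incid p (f t))).card := by
  rw [dg, Finset.filter_image, Finset.card_image_of_injOn]
  exact (Finset.card_image_iff.mp hf).mono (fun t ht => Finset.mem_coe.mpr (Finset.mem_filter.mp (Finset.mem_coe.mp ht)).1)

theorem dg_T1 (e : ℤ) {x y z : F} (hz : z ≠ 0) :
    dg (T1 F e) (pt x y z) = if quadraticChar F (y / z) = e then 1 else 0 := by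
  rw [T1, dg_image _ _ (card_T1 e), card_filter_single e _ (y / z)]
  intro t
  rw [incid_pt (by simp) (by simp [hz]), eq_div_iff hz]
  constructor <;> intro h <;> linear_combination -h

theorem dg_T2 (e : ℤ) {x y z : F} (hx : x ≠ 0) :
    dg (T2 F e) (pt x y z) = if quadraticChar F (z / x) = e then 1 else 0 := by
  rw [T2, dg_image _ _ (card_T2 e), card_filter_single e _ (z / x)]
  intro t
  rw [incid_pt (by simp) (by simp [hx]), eq_div_iff hx]
  constructor <;> intro h <;> linear_combination -h

theorem dg_T3 (e : ℤ) {x y z : F} (hy : y ≠ 0) :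
    dg (T3 F e) (pt x y z) = if quadraticChar F (x / y) = e then 1 else 0 := by
  rw [T3, dg_image _ _ (card_T3 e), card_filter_single e _ (x / y)]
  intro t
  rw [incid_pt (by simp) (by simp [hy]), eq_div_iff hy]
  constructor <;> intro h <;> linear_combination -h

/-- family T -/
theorem famT (hq : Odd (Fintype.card F)) (s : ℕ) (hs : 2 * s + 1 ≤ Fintype.card F) :
    ∃ R : Finset (PG F), 2 * R.card + 3 = 2 * (s * Fintype.card F) + 3 * Fintype.card F ∧
      (od R).card ≤ 3 * (Fintype.card F + 1) ∧
      ∃ X, Fintype.card F ≤ 2 * dg R X + 1 := by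
  obtain ⟨e, he, hes⟩ : ∃ e : ℤ, (e = 1 ∨ e = -1) ∧ ((Odd s ∧ e = 1) ∨ (Even s ∧ e = -1)) := by
    rcases Nat.even_or_odd s with h | h
    · exact ⟨-1, by simp, by simp [h]⟩
    · exact ⟨1, by simp, by simp [h]⟩
  have hc1 := card_qs hq (e := 1) (by simp)
  have hce := card_qs hq he
  have hne : -e = 1 ∨ -e = -1 := by rcases he with rfl | rfl <;> simp
  obtain ⟨B, hB, hc⟩ := Finset.exists_subset_card_eq (s := qs F (-e)) (n := s)
    (by have := card_qs hq hne; omega)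
  set A : Finset (PG F) := B.image (fun u => pt u 1 0) with hAdef
  have hcA : A.card = s := by
    rw [hAdef, Finset.card_image_of_injective, hc]
    intro u v h
    obtain ⟨w, h1, h2, -⟩ := pt_eq (by simp) (by simp) h
    have : w = 1 := by simpa using h2
    rw [this, one_mul] at h1
    exact h1.symm
  have hA' : ∀ a ∈ A, Incid a (pt 0 0 1) := by
    intro a ha
    obtain ⟨u, -, rfl⟩ := Finset.mem_image.mp ha
    rw [incid_pt (by simp) (by simp)]
    simp
  have hd12 : Disjoint (T1 F 1) (T2 F 1) := by
    rw [Finset.disjoint_left]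
    intro m hm hm'
    obtain ⟨c, hc, rfl⟩ := Finset.mem_image.mp hm
    obtain ⟨d, hd, h⟩ := Finset.mem_image.mp hm'
    obtain ⟨u, h1, h2, h3⟩ := pt_eq (by simp) (by simp) h
    have := qs_ne (by simp) hd
    simp at h1
    exact this h1
  have hd123 : Disjoint (T1 F 1 ∪ T2 F 1) (T3 F e) := by
    rw [Finset.disjoint_left]
    intro m hm hm'
    obtain ⟨d, hd, h⟩ := Finset.mem_image.mp hm'
    rcases Finset.mem_union.mp hm with hm | hm
    · obtain ⟨c, hc, rfl⟩ := Finset.mem_image.mp hm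
      obtain ⟨u, h1, h2, h3⟩ := pt_eq (by simp) (by simp) h
      simp at h1
    · obtain ⟨c, hc, rfl⟩ := Finset.mem_image.mp hm
      obtain ⟨u, h1, h2, h3⟩ := pt_eq (by simp) (by simp) h
      simp at h3
      simp [h3] at h1
  have hdP : Disjoint (T1 F 1 ∪ T2 F 1 ∪ T3 F e) (pen (pt 0 0 1) A) := by
    rw [Finset.disjoint_left]
    intro m hm hm'
    obtain ⟨a, ha, hin, -⟩ := mem_pen.mp hm'
    obtain ⟨u, hu, rfl⟩ := Finset.mem_image.mp ha
    have hu0 := qs_ne hne (hB hu)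
    have hu' := mem_qs.mp (hB hu)
    rcases Finset.mem_union.mp hm with hm | hm
    · rcases Finset.mem_union.mp hm with hm | hm
      · obtain ⟨c, hc, rfl⟩ := Finset.mem_image.mp hm
        rw [incid_pt (by simp) (by simp)] at hin
        simp at hin
      · obtain ⟨c, hc, rfl⟩ := Finset.mem_image.mp hm
        have := qs_ne (by simp) hc
        rw [incid_pt (by simp) (by simp)] at hin
        simp at hin
        tauto
    · obtain ⟨c, hc, rfl⟩ := Finset.mem_image.mp hm
      rw [incid_pt (by simp) (by simp)] at hin
      have hcu : u = c := by linear_combination hin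
      rw [hcu, mem_qs.mp hc] at hu'
      rcases he with rfl | rfl <;> norm_num at hu'
  refine ⟨T1 F 1 ∪ T2 F 1 ∪ T3 F e ∪ pen (pt 0 0 1) A, ?_, ?_, ?_⟩
  · rw [Finset.card_union_of_disjoint hdP, Finset.card_union_of_disjoint hd123,
      Finset.card_union_of_disjoint hd12, card_T1, card_T2, card_T3, card_pen hA', hcA]
    omega
  · have hsub : od (T1 F 1 ∪ T2 F 1 ∪ T3 F e ∪ pen (pt 0 0 1) A)
        ⊆ (univ.filter (fun p => Incid p (pt 1 0 0)) ∪ univ.filter (fun p => Incid p (pt 0 1 0)))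
          ∪ univ.filter (fun p => Incid p (pt 0 0 1)) := by
      intro p hp
      obtain ⟨x, y, z, h0, rfl⟩ := exists_pt p
      simp only [mem_union, mem_filter, mem_univ, true_and]
      rw [incid_pt (by simp) h0, incid_pt (by simp) h0, incid_pt (by simp) h0]
      simp only [mul_one, mul_zero, add_zero, zero_add]
      by_contra! hcon
      obtain ⟨⟨hx, hy⟩, hz⟩ := hcon
      rw [od, Finset.mem_filter, dg_union hdP, dg_union hd123, dg_union hd12, dg_T1 _ hz,
        dg_T2 _ hx, dg_T3 _ hy, dg_pen hA' (by rw [incid_pt (by simp) h0]; simpa using hz),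
        hcA] at hp
      have hodd := hp.2
      have hprod : quadraticChar F (y / z) * quadraticChar F (z / x) * quadraticChar F (x / y)
          = 1 := by
        rw [← map_mul, ← map_mul]
        have : y / z * (z / x) * (x / y) = 1 := by field_simp
        rw [this, map_one]
      have e1 := quadraticChar_dichotomy (div_ne_zero hy hz)
      have e2 := quadraticChar_dichotomy (div_ne_zero hz hx)
      have e3 := quadraticChar_dichotomy (div_ne_zero hx hy)
      generalize quadraticChar F (y / z) = a1 at *
      generalize quadraticChar F (z / x) = a2 at *
      generalize quadraticChar F (x / y) = a3 at *
      rw [Nat.odd_iff] at hodd hes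
      rw [Nat.even_iff] at hes
      rcases hes with ⟨hpar, rfl⟩ | ⟨hpar, rfl⟩ <;> rcases e1 with rfl | rfl <;>
        rcases e2 with rfl | rfl <;> rcases e3 with rfl | rfl <;>
        first
        | (norm_num at hprod; done)
        | (norm_num at hodd; done)
        | (norm_num at hodd; omega)
    refine le_trans (Finset.card_le_card hsub) (le_trans (Finset.card_union_le _ _) ?_)
    have h1 := Finset.card_union_le (univ.filter (fun p : PG F => Incid p (pt 1 0 0)))
      (univ.filter (fun p => Incid p (pt 0 1 0)))
    simp only [card_points_on] at h1 ⊢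
    omega
  · refine ⟨pt 1 0 0, ?_⟩
    have h1 : (T1 F 1).card ≤ dg (T1 F 1 ∪ T2 F 1 ∪ T3 F e ∪ pen (pt 0 0 1) A) (pt 1 0 0) := by
      apply Finset.card_le_card
      intro m hm
      rw [Finset.mem_filter]
      refine ⟨by simp [hm], ?_⟩
      obtain ⟨c, hc, rfl⟩ := Finset.mem_image.mp hm
      rw [incid_pt (by simp) (by simp)]
      simp
    rw [card_T1] at h1
    omega

theorem core_select (hq : 1000 ≤ Fintype.card F) (M : Finset (PG F)) (X : PG F) (k : ℕ)
    (hk : k ≤ dg M X) (hk4 : 4 * k ≤ Fintype.card F + 8) (hM : Fintype.card F + 25 ≤ M.card) :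
    ∃ K ⊆ M, K.card = k ∧ 4 * (3 * (Fintype.card F + 1) + (od K).card)
      < Fintype.card F ^ 2 + 4 * Fintype.card F + 3 := by
  rcases Nat.lt_or_ge k 24 with h | h
  · obtain ⟨K, h1, h2, h3⟩ := exists_saving M X k 0 hk (Nat.zero_le _) (by omega)
    refine ⟨K, h1, h2, ?_⟩
    generalize Fintype.card F = q at *
    have : k * (q + 1) ≤ 24 * (q + 1) := Nat.mul_le_mul_right _ h.le
    nlinarith
  · obtain ⟨K, h1, h2, h3⟩ := exists_saving M X k 24 hk h (by omega)
    refine ⟨K, h1, h2, ?_⟩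
    generalize Fintype.card F = q at *
    obtain ⟨i, rfl⟩ := Nat.exists_eq_add_of_le h
    rw [Nat.add_sub_cancel_left] at h3
    have h4 : 4 * i ≤ q - 88 := by omega
    obtain ⟨w, rfl⟩ := Nat.exists_eq_add_of_le hq
    have h5 : (4 * i) * (977 + w) ≤ (912 + w) * (977 + w) :=
      Nat.mul_le_mul_right _ (by omega)
    nlinarith

theorem step_add (hq : 1000 ≤ Fintype.card F) (R : Finset (PG F))
    (hR : (od R).card ≤ 3 * (Fintype.card F + 1))
    (hc : 2 * R.card ≤ Fintype.card F ^ 2 + 3 * Fintype.card F) (k : ℕ)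
    (hk4 : 4 * k ≤ Fintype.card F + 8) :
    4 * fmin F (R.card + k) < Fintype.card F ^ 2 + 4 * Fintype.card F + 3 := by
  have hcc : Rᶜ.card + R.card = Fintype.card F ^ 2 + Fintype.card F + 1 := by
    rw [← card_pg, Finset.card_compl, Nat.sub_add_cancel (Finset.card_le_univ R)]
  obtain ⟨X, hX⟩ := exists_rich Rᶜ k (by
    rw [card_pg]
    generalize Fintype.card F = q at *
    generalize Rᶜ.card = c at *
    generalize R.card = d at *
    have h1 : q ^ 2 + 2 ≤ 2 * c + q := by omega
    have h2 : (q ^ 2 + q + 1) * (4 * k) ≤ (q ^ 2 + q + 1) * (q + 8) := Nat.mul_le_mul_left _ hk4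
    have h3 : (q ^ 2 + 2) * (q + 1) ≤ (2 * c + q) * (q + 1) := Nat.mul_le_mul_right _ h1
    nlinarith [Nat.mul_le_mul_right (q ^ 2) hq, Nat.mul_le_mul_right q hq])
  obtain ⟨K, h1, h2, h3⟩ := core_select hq Rᶜ X k hX hk4 (by
    generalize Fintype.card F = q at *
    nlinarith)
  have hd : Disjoint R K := by
    rw [Finset.disjoint_left]
    intro a ha ha'
    exact (Finset.mem_compl.mp (h1 ha')) ha
  have h4 := fmin_le (R ∪ K)
  have h5 := od_union hd
  rw [Finset.card_union_of_disjoint hd, h2] at h4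
  omega

theorem step_sub (hq : 1000 ≤ Fintype.card F) (R : Finset (PG F))
    (hR : (od R).card ≤ 3 * (Fintype.card F + 1))
    (hc : Fintype.card F + 25 ≤ R.card) (X : PG F) (hX : Fintype.card F ≤ 2 * dg R X + 1) (k : ℕ)
    (hk4 : 4 * k ≤ Fintype.card F + 8) :
    4 * fmin F (R.card - k) < Fintype.card F ^ 2 + 4 * Fintype.card F + 3 := by
  obtain ⟨K, h1, h2, h3⟩ := core_select hq R X k (by omega) hk4 hc
  have h4 := fmin_le (R \ K)
  have h5 := od_sdiff h1
  rw [Finset.card_sdiff_of_subset h1, h2] at h4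
  omega

theorem mid_range (hodd : Odd (Fintype.card F)) (hq : 1000 ≤ Fintype.card F) (r : ℕ)
    (h1 : Fintype.card F + 2 ≤ r) (h2 : 2 * r ≤ Fintype.card F ^ 2 + Fintype.card F) :
    4 * fmin F r < Fintype.card F ^ 2 + 4 * Fintype.card F + 3 := by
  obtain ⟨q, hqd⟩ : ∃ q, q = Fintype.card F := ⟨_, rfl⟩
  have famE' := famE (F := F)
  have famC' := famC (F := F) hodd
  have famT' := famT (F := F) hodd
  have sa := step_add (F := F) hq
  have ss := step_sub (F := F) hq
  rw [← hqd] at hodd hq h1 h2 famE' famC' famT' sa ss ⊢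
  have hq0 : 0 < q := by omega
  -- grid points of the first kind
  have hG : ∀ m, 1 ≤ m → 2 * m ≤ q + 1 → ∃ R : Finset (PG F),
      m * q ≤ R.card ∧ R.card ≤ m * q + 1 ∧ (od R).card ≤ 3 * (q + 1) ∧
      (2 ≤ m → ∃ X, q ≤ 2 * dg R X + 1) := by
    intro m hm1 hm2
    rcases Nat.even_or_odd m with he | ho
    · obtain ⟨R, a, b, X, c⟩ := famE' m (by omega) he (by rcases he with ⟨t, rfl⟩; omega)
      exact ⟨R, by omega, by omega, b, fun _ => ⟨X, by omega⟩⟩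
    · obtain ⟨t, rfl⟩ := ho
      obtain ⟨R, a, b, c⟩ := famC' (2 * t) (by omega) (by simp)
      refine ⟨R, by rw [a]; ring_nf; omega, by rw [a]; ring_nf; omega, b, fun h => ?_⟩
      obtain ⟨X, hX⟩ := c (by omega)
      exact ⟨X, by omega⟩
  obtain ⟨m, hm⟩ : ∃ m, m = r / q := ⟨_, rfl⟩
  obtain ⟨ρ, hρ⟩ : ∃ ρ, ρ = r % q := ⟨_, rfl⟩
  have hr : r = m * q + ρ := by
    rw [hm, hρ, mul_comm]; exact (Nat.div_add_mod r q).symm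
  have hρq : ρ < q := by rw [hρ]; exact Nat.mod_lt _ hq0
  have hm1 : 1 ≤ m := by
    rw [hm, Nat.one_le_div_iff hq0]; omega
  have hm2 : 2 * m ≤ q + 1 := by
    by_contra! hc
    have : (q + 2) * q ≤ 2 * m * q := Nat.mul_le_mul_right _ hc
    nlinarith
  have hmq : 2 * m * q ≤ (q + 1) * q := Nat.mul_le_mul_right _ hm2
  have hm2' : 2 * m = q + 1 → ρ = 0 := by
    intro h
    have : 2 * m * q = (q + 1) * q := by rw [h]
    nlinarith
  rcases Nat.lt_or_ge q (4 * ρ) with hlo | hlo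
  · -- ρ > q/4
    have hm3 : 2 * m + 1 ≤ q := by
      by_contra hc
      have := hm2' (by obtain ⟨t, ht⟩ := hodd; omega)
      omega
    rcases Nat.lt_or_ge (3 * q) (4 * ρ) with hhi | hhi
    · have hm4 : 2 * (m + 1) ≤ q + 1 := by obtain ⟨t, ht⟩ := hodd; omega
      obtain ⟨R, a, b, c, d⟩ := hG (m + 1) (by omega) hm4
      obtain ⟨X, hX⟩ := d (by omega)
      have e1 : (m + 1) * q = m * q + q := by ring
      have e2 : 1 * q ≤ m * q := Nat.mul_le_mul_right _ hm1
      have := ss R c (by omega) X hX (R.card - r) (by omega)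
      rwa [Nat.sub_sub_self (by omega)] at this
    · obtain ⟨n, rfl⟩ : ∃ n, m = n + 1 := ⟨m - 1, by omega⟩
      obtain ⟨R, a, c, X, hX⟩ := famT' n (by omega)
      have e1 : (n + 1) * q = n * q + q := by ring
      rcases le_total r R.card with hle | hle
      · have := ss R c (by omega) X hX (R.card - r) (by omega)
        rwa [Nat.sub_sub_self hle] at this
      · have := sa R c (by nlinarith) (r - R.card) (by omega)
        rwa [Nat.add_sub_cancel' hle] at this
  · obtain ⟨R, a, b, c, d⟩ := hG m hm1 hm2
    rcases le_total R.card r with hle | hle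
    · have := sa R c (by nlinarith) (r - R.card) (by omega)
      rwa [Nat.add_sub_cancel' hle] at this
    · rcases Nat.lt_or_ge m 2 with hm' | hm'
      · have : m = 1 := by omega
        subst this
        omega
      · obtain ⟨X, hX⟩ := d hm'
        have e2 : 2 * q ≤ m * q := Nat.mul_le_mul_right _ hm'
        have := ss R c (by omega) X hX (R.card - r) (by omega)
        rwa [Nat.sub_sub_self hle] at this

theorem low_range (r : ℕ) (hr : r ≤ Fintype.card F + 1) :
    (fmin F r : ℤ) = (r : ℤ) * (Fintype.card F + 2 - r) := by
  apply le_antisymm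
  · obtain ⟨K, hK, hc⟩ := Finset.exists_subset_card_eq (s := con F) (n := r)
      (by rw [card_con]; exact hr)
    have h1 := od_con_sub hK
    have h2 := fmin_le K
    rw [hc] at h1 h2
    rw [← h1]
    exact_mod_cast h2
  · obtain ⟨R, h1, h2⟩ := fmin_attained (F := F) r (by rw [card_pg]; nlinarith)
    have := od_lower R
    rw [h1, h2] at this
    exact this

theorem fmin_symm_le (hq : Odd (Fintype.card F)) (r : ℕ) (hr : r ≤ Fintype.card (PG F)) :
    fmin F (Fintype.card (PG F) - r) ≤ fmin F r := by
  obtain ⟨R, h1, h2⟩ := fmin_attained (F := F) r hr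
  have := fmin_le Rᶜ
  rwa [Finset.card_compl, od_compl hq, h1, h2] at this

theorem fmin_symm (hq : Odd (Fintype.card F)) (r : ℕ)
    (hr : r ≤ Fintype.card F ^ 2 + Fintype.card F + 1) :
    fmin F (Fintype.card F ^ 2 + Fintype.card F + 1 - r) = fmin F r := by
  rw [← card_pg] at *
  apply le_antisymm (fmin_symm_le hq r hr)
  have := fmin_symm_le hq (Fintype.card (PG F) - r) (Nat.sub_le _ _)
  rwa [Nat.sub_sub_self hr] at this

theorem half_range (hodd : Odd (Fintype.card F)) (hq : 1000 ≤ Fintype.card F) (t : ℕ)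
    (ht : Fintype.card F = 2 * t + 1) (r : ℕ)
    (h2 : 2 * r ≤ Fintype.card F ^ 2 + Fintype.card F) :
    fmin F r ≤ (t + 1) * (t + 2) ∧ (fmin F r = (t + 1) * (t + 2) ↔ r = t + 1 ∨ r = t + 2) := by
  rcases Nat.lt_or_ge r (Fintype.card F + 2) with h | h
  · have h3 := low_range (F := F) r (by omega)
    rw [ht] at h3 hq h
    push_cast at h3
    have h4 : (fmin F r : ℤ) + ((r : ℤ) - (t + 1)) * (r - (t + 2)) = (t + 1) * (t + 2) := by
      rw [h3]; ring
    have h5 : 0 ≤ ((r : ℤ) - (t + 1)) * (r - (t + 2)) := by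
      rcases Nat.lt_or_ge r (t + 2) with h | h
      · have : (r : ℤ) ≤ t + 1 := by omega
        nlinarith
      · have : (t : ℤ) + 2 ≤ r := by omega
        nlinarith
    constructor
    · zify; linarith
    · zify
      constructor
      · intro h6
        have h7 : ((r : ℤ) - (t + 1)) * (r - (t + 2)) = 0 := by linarith
        rcases mul_eq_zero.mp h7 with h | h
        · left; linarith
        · right; linarith
      · rintro (h | h)
        · rw [h] at h4; linarith
        · rw [h] at h4; linarith
  · have h3 := mid_range hodd hq r h h2
    rw [ht] at h3 h hq
    have h4 : fmin F r < (t + 1) * (t + 2) := by nlinarith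
    exact ⟨h4.le, ⟨fun h5 => by omega, fun h5 => by omega⟩⟩

end helpers

/-- For all sufficiently large odd prime powers `q`, the maximum value of
`f(r)` over `0 ≤ r ≤ N` is `(q² + 4q + 3)/4`, attained exactly at
`r = (q+1)/2`, `r = (q+3)/2`, `r = N − (q+1)/2`, and `r = N − (q+3)/2`.
(All the divisions by `2` and `4` are exact since `q` is odd.) -/
theorem stmt17 :
    ∃ q₀ : ℕ, ∀ (F : Type) [Field F] [Fintype F], ∀ q : ℕ,
      Fintype.card F = q → Odd q → q₀ ≤ q →
      (∀ r : ℕ, r ≤ q ^ 2 + q + 1 →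
        fmin F r ≤ (q ^ 2 + 4 * q + 3) / 4) ∧
      (∀ r : ℕ, r ≤ q ^ 2 + q + 1 →
        (fmin F r = (q ^ 2 + 4 * q + 3) / 4 ↔
          r = (q + 1) / 2 ∨ r = (q + 3) / 2 ∨
          r = q ^ 2 + q + 1 - (q + 1) / 2 ∨ r = q ^ 2 + q + 1 - (q + 3) / 2)) := by
  refine ⟨1000, ?_⟩
  intro F _ _ q hF hodd hq
  subst hF
  obtain ⟨t, ht⟩ := hodd
  have hodd : Odd (Fintype.card F) := ⟨t, ht⟩
  have hhalf := half_range hodd hq t ht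
  have hsymm := fmin_symm (F := F) hodd
  have e1 : (Fintype.card F ^ 2 + 4 * Fintype.card F + 3) / 4 = (t + 1) * (t + 2) := by
    apply Nat.div_eq_of_eq_mul_right (by norm_num)
    rw [ht]; ring
  have e2 : (Fintype.card F + 1) / 2 = t + 1 := by omega
  have e3 : (Fintype.card F + 3) / 2 = t + 2 := by omega
  have hN : 1000 * Fintype.card F ≤ Fintype.card F ^ 2 := by nlinarith
  rw [e1, e2, e3]
  have hev : (Fintype.card F ^ 2 + Fintype.card F) % 2 = 0 := by
    rw [ht]; ring_nf; omega
  have main : ∀ r : ℕ, r ≤ Fintype.card F ^ 2 + Fintype.card F + 1 →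
      fmin F r ≤ (t + 1) * (t + 2) ∧ (fmin F r = (t + 1) * (t + 2) ↔
        r = t + 1 ∨ r = t + 2 ∨ r = Fintype.card F ^ 2 + Fintype.card F + 1 - (t + 1) ∨
        r = Fintype.card F ^ 2 + Fintype.card F + 1 - (t + 2)) := by
    intro r hr
    rcases le_or_gt (2 * r) (Fintype.card F ^ 2 + Fintype.card F) with h | h
    · obtain ⟨a, b⟩ := hhalf r h
      refine ⟨a, b.trans ?_⟩
      omega
    · obtain ⟨a, b⟩ := hhalf (Fintype.card F ^ 2 + Fintype.card F + 1 - r) (by omega)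
      rw [hsymm r hr] at a b
      refine ⟨a, b.trans ?_⟩
      omega
  exact ⟨fun r hr => (main r hr).1, fun r hr => (main r hr).2⟩
end

section
/- Let q ≥ 5 be an odd prime power and let 𝒰 be a nonempty set of lines of PG(2,q) such that no set of 2 points meets every line of 𝒰. Then there exists a near-blocker of 𝒰 of size at most |𝒰|/3 + (q + 1)/6, i.e., a set C of points that meets every line of 𝒰 except exactly one. -/
open scoped BigOperators

section Abstract

open Finset Classical

/-- Two distinct lines share exactly one point: some point of `l` is off `m`. -/
theorem nb_exists_off {P L : Type*} [Fintype P] (I : P → L → Prop) (n : ℕ) (hn : 5 ≤ n)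
    (h2 : ∀ p r l m, I p l → I r l → I p m → I r m → p = r ∨ l = m)
    (h3 : ∀ l, (univ.filter (fun p => I p l)).card = n + 1)
    (l m : L) (hlm : l ≠ m) : ∃ p, I p l ∧ ¬ I p m := by
  have : 1 < (univ.filter (fun p => I p l)).card := by rw [h3]; omega
  obtain ⟨p, hp, r, hr, hpr⟩ := Finset.one_lt_card.1 this
  simp only [mem_filter, mem_univ, true_and] at hp hr
  by_contra hc
  push Not at hc
  rcases h2 p r l m hp hr (hc p hp) (hc r hr) with h | h
  · exact hpr h
  · exact hlm h

theorem nb_inter_card {P L : Type*} [Fintype P] (I : P → L → Prop)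
    (h1 : ∀ l m : L, l ≠ m → ∃ p, I p l ∧ I p m)
    (h2 : ∀ p r l m, I p l → I r l → I p m → I r m → p = r ∨ l = m)
    (l m : L) (hlm : l ≠ m) :
    ((univ.filter (fun p => I p l)).filter (fun p => I p m)).card = 1 := by
  obtain ⟨p, hp, hp'⟩ := h1 l m hlm
  rw [Finset.card_eq_one]
  refine ⟨p, ?_⟩
  ext r
  simp only [mem_filter, mem_univ, true_and, mem_singleton]
  constructor
  · rintro ⟨a, b⟩
    exact (h2 r p l m a hp b hp').resolve_right hlm
  · rintro rfl
    exact ⟨hp, hp'⟩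

/-- Dual arcs in a plane of odd order `n` have at most `n + 1` lines. -/
theorem nb_arc_bound {P L : Type*} [Fintype P] [Fintype L] (I : P → L → Prop) (n : ℕ)
    (hodd : Odd n)
    (h1 : ∀ l m : L, l ≠ m → ∃ p, I p l ∧ I p m)
    (h2 : ∀ p r l m, I p l → I r l → I p m → I r m → p = r ∨ l = m)
    (h3 : ∀ l, (univ.filter (fun p => I p l)).card = n + 1)
    (h4 : n + 2 < Fintype.card L)
    (U : Finset L) (harc : ∀ p, (U.filter (fun l => I p l)).card ≤ 2) :
    U.card ≤ n + 1 := by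
  have key : ∀ l, ∑ p ∈ univ.filter (fun p => I p l), (U.filter (fun m => I p m)).card
      = ∑ m ∈ U, ((univ.filter (fun p => I p l)).filter (fun p => I p m)).card := fun l =>
    Finset.sum_card_bipartiteAbove_eq_sum_card_bipartiteBelow I
  have hin : ∀ l ∈ U, ∑ p ∈ univ.filter (fun p => I p l), (U.filter (fun m => I p m)).card
      = U.card + n := by
    intro l hl
    rw [key, ← Finset.add_sum_erase _ _ hl,
      Finset.sum_congr rfl (g := fun _ => 1)
        (fun m hm => nb_inter_card I h1 h2 l m (Finset.ne_of_mem_erase hm).symm)]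
    have := Finset.card_pos.2 ⟨l, hl⟩
    have h := h3 l
    rw [Finset.filter_filter]
    simp only [and_self, sum_const, smul_eq_mul, mul_one, Finset.card_erase_of_mem hl]
    rw [h]
    omega
  have hout : ∀ l, l ∉ U → ∑ p ∈ univ.filter (fun p => I p l), (U.filter (fun m => I p m)).card
      = U.card := by
    intro l hl
    rw [key, Finset.sum_congr rfl (g := fun _ => 1)
        (fun m hm => nb_inter_card I h1 h2 l m (fun h => hl (h ▸ hm)))]
    simp
  by_contra hgt
  push Not at hgt
  have hle : ∀ l ∈ U, U.card + n ≤ 2 * (n + 1) := by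
    intro l hl
    rw [← hin l hl, ← h3 l, mul_comm]
    exact Finset.sum_le_card_nsmul _ _ _ (fun p _ => harc p)
  obtain ⟨l0, hl0⟩ : U.Nonempty := Finset.card_pos.1 (by omega)
  have hcard : U.card = n + 2 := by have := hle l0 hl0; omega
  have htwo : ∀ l ∈ U, ∀ p, I p l → (U.filter (fun m => I p m)).card = 2 := by
    intro l hl p hp
    have hs : ∑ p ∈ univ.filter (fun p => I p l), (U.filter (fun m => I p m)).card
        = ∑ p ∈ univ.filter (fun p => I p l), 2 := by
      rw [hin l hl, Finset.sum_const, h3, hcard, smul_eq_mul]; ring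
    exact (Finset.sum_eq_sum_iff_of_le (fun p _ => harc p)).1 hs p (by simpa using hp)
  obtain ⟨m, hm⟩ : ∃ m, m ∉ U := by
    by_contra hc
    push Not at hc
    have : U = univ := Finset.eq_univ_iff_forall.2 hc
    rw [this, Finset.card_univ] at hcard
    omega
  have hev : Even (∑ p ∈ univ.filter (fun p => I p m), (U.filter (fun l => I p l)).card) := by
    apply Finset.even_sum
    intro p _
    rcases (U.filter (fun l => I p l)).eq_empty_or_nonempty with h | ⟨l, hl⟩
    · rw [h]; simp
    · rw [mem_filter] at hl
      rw [htwo l hl.1 p hl.2]; exact even_two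
  rw [hout m hm, hcard] at hev
  obtain ⟨a, ha⟩ := hodd
  obtain ⟨b, hb⟩ := hev
  omega

/-- Pairing up the lines of a dual arc away from the line `l0`. -/
theorem nb_pairing {P L : Type*} (I : P → L → Prop)
    (h1 : ∀ l m : L, l ≠ m → ∃ p, I p l ∧ I p m)
    (hoff : ∀ l m : L, l ≠ m → ∃ p, I p l ∧ ¬ I p m)
    (l0 : L) (k : ℕ) : ∀ S : Finset L, S.card = k → l0 ∉ S →
      (∀ l ∈ S, ∀ m ∈ S, l ≠ m → ∀ p, I p l → I p m → ¬ I p l0) →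
      ∃ C : Finset P, 2 * C.card ≤ S.card + 1 ∧ (∀ l ∈ S, ∃ p ∈ C, I p l) ∧
        ∀ p ∈ C, ¬ I p l0 := by
  induction k using Nat.strong_induction_on with
  | _ k ih =>
  intro S hS hl0 harc
  by_cases hk0 : S = ∅
  · subst hk0; exact ⟨∅, by simp, by simp, by simp⟩
  obtain ⟨l, hl⟩ := Finset.nonempty_iff_ne_empty.2 hk0
  by_cases hk1 : S.erase l = ∅
  · obtain ⟨p, hp, hp'⟩ := hoff l l0 (fun h => hl0 (h ▸ hl))
    refine ⟨{p}, ?_, ?_, by simpa using hp'⟩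
    · have := Finset.card_pos.2 ⟨l, hl⟩
      simp only [card_singleton]; omega
    · intro m hm
      by_cases hml : m = l
      · exact ⟨p, by simp, hml ▸ hp⟩
      · have : m ∈ S.erase l := Finset.mem_erase.2 ⟨hml, hm⟩
        simp [hk1] at this
  obtain ⟨m, hm⟩ := Finset.nonempty_iff_ne_empty.2 hk1
  have hmS := Finset.mem_of_mem_erase hm
  have hml := Finset.ne_of_mem_erase hm
  have hc : ((S.erase l).erase m).card + 2 = S.card := by
    have a := Finset.card_erase_add_one hm
    have b := Finset.card_erase_add_one hl
    omega
  have hsub : ∀ x ∈ (S.erase l).erase m, x ∈ S := fun x hx =>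
    Finset.mem_of_mem_erase (Finset.mem_of_mem_erase hx)
  obtain ⟨C, hC, hcov, hC0⟩ := ih _ (by omega : ((S.erase l).erase m).card < k)
    ((S.erase l).erase m) rfl (fun h => hl0 (hsub _ h))
    (fun x hx y hy => harc x (hsub x hx) y (hsub y hy))
  obtain ⟨p, hpl, hpm⟩ := h1 l m hml.symm
  refine ⟨insert p C, ?_, ?_, ?_⟩
  · have := Finset.card_insert_le p C
    omega
  · intro x hx
    by_cases hxl : x = l
    · exact ⟨p, by simp, hxl ▸ hpl⟩
    by_cases hxm : x = m
    · exact ⟨p, by simp, hxm ▸ hpm⟩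
    obtain ⟨r, hr, hrx⟩ := hcov x
      (Finset.mem_erase.2 ⟨hxm, Finset.mem_erase.2 ⟨hxl, hx⟩⟩)
    exact ⟨r, Finset.mem_insert_of_mem hr, hrx⟩
  · intro r hr
    rcases Finset.mem_insert.1 hr with rfl | hr
    · exact harc l hl m hmS hml.symm _ hpl hpm
    · exact hC0 r hr

/-- The case of three blocking points, with few lines only through `p`. -/
theorem nb_three {P L : Type*} (I : P → L → Prop) (n : ℕ) (hn : 5 ≤ n)
    (hoff : ∀ l m : L, l ≠ m → ∃ p, I p l ∧ ¬ I p m)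
    (U : Finset L) (hU : ∀ p r, ∃ l ∈ U, ¬ I p l ∧ ¬ I r l)
    (p r s : P) (hcov : ∀ l ∈ U, I p l ∨ I r l ∨ I s l)
    (hsmall : 3 * (U.filter (fun l => I p l ∧ ¬ I r l ∧ ¬ I s l)).card ≤ U.card) :
    ∃ C : Finset P, 6 * C.card ≤ 2 * U.card + n + 1 ∧
      ∃ l ∈ U, (∀ x ∈ C, ¬ I x l) ∧ ∀ m ∈ U, m ≠ l → ∃ x ∈ C, I x m := by
  obtain ⟨l, hl, hlr, hls⟩ := hU r s
  have hlp : I p l := by have := hcov l hl; tauto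
  set A := U.filter (fun l => I p l ∧ ¬ I r l ∧ ¬ I s l) with hA
  have hlA : l ∈ A := by simp [hA, hl, hlp, hlr, hls]
  have hf : ∀ m : L, ∃ x : P, m ≠ l → I x m ∧ ¬ I x l := by
    intro m
    by_cases h : m = l
    · exact ⟨p, fun h' => absurd h h'⟩
    · obtain ⟨x, hx⟩ := hoff m l h
      exact ⟨x, fun _ => hx⟩
  choose f hf using hf
  refine ⟨insert r (insert s ((A.erase l).image f)), ?_, l, hl, ?_, ?_⟩
  · have a := Finset.card_insert_le r (insert s ((A.erase l).image f))
    have b := Finset.card_insert_le s ((A.erase l).image f)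
    have c : ((A.erase l).image f).card ≤ (A.erase l).card := Finset.card_image_le
    have d := Finset.card_erase_add_one hlA
    omega
  · intro x hx
    simp only [Finset.mem_insert, Finset.mem_image] at hx
    rcases hx with rfl | rfl | ⟨m, hm, rfl⟩
    · exact hlr
    · exact hls
    · exact (hf m (Finset.ne_of_mem_erase hm)).2
  · intro m hm hml
    by_cases hr : I r m
    · exact ⟨r, by simp, hr⟩
    by_cases hs : I s m
    · exact ⟨s, by simp, hs⟩
    have hmA : m ∈ A := by
      have := hcov m hm
      simp only [hA, mem_filter]
      tauto
    exact ⟨f m, Finset.mem_insert_of_mem (Finset.mem_insert_of_mem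
      (Finset.mem_image_of_mem f (Finset.mem_erase.2 ⟨hml, hmA⟩))), (hf m hml).1⟩

theorem nb_main {P L : Type*} [Fintype P] [Fintype L] (I : P → L → Prop) (n : ℕ)
    (hodd : Odd n) (hn : 5 ≤ n) (p0 : P)
    (h1 : ∀ l m : L, l ≠ m → ∃ p, I p l ∧ I p m)
    (h2 : ∀ p r l m, I p l → I r l → I p m → I r m → p = r ∨ l = m)
    (h3 : ∀ l, (univ.filter (fun p => I p l)).card = n + 1)
    (h4 : n + 2 < Fintype.card L) (k : ℕ) :
    ∀ U : Finset L, U.card = k → (∀ p r, ∃ l ∈ U, ¬ I p l ∧ ¬ I r l) →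
    ∃ C : Finset P, 6 * C.card ≤ 2 * U.card + n + 1 ∧
      ∃ l ∈ U, (∀ x ∈ C, ¬ I x l) ∧ ∀ m ∈ U, m ≠ l → ∃ x ∈ C, I x m := by
  have hoff := nb_exists_off I n hn h2 h3
  induction k using Nat.strong_induction_on with
  | _ k ih =>
  intro U hk hU
  by_cases harc : ∀ p, (U.filter (fun l => I p l)).card ≤ 2
  · have hb := nb_arc_bound I n hodd h1 h2 h3 h4 U harc
    obtain ⟨l, hl, -⟩ := hU p0 p0
    obtain ⟨C, hC, hcov, hC0⟩ := nb_pairing I h1 hoff l _ (U.erase l) rfl (by simp) (by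
      intro x hx y hy hxy p hpx hpy hpl
      have hsub : ({x, y, l} : Finset L) ⊆ U.filter (fun l => I p l) := by
        intro z hz
        simp only [Finset.mem_insert, Finset.mem_singleton] at hz
        rw [mem_filter]
        rcases hz with rfl | rfl | rfl
        · exact ⟨Finset.mem_of_mem_erase hx, hpx⟩
        · exact ⟨Finset.mem_of_mem_erase hy, hpy⟩
        · exact ⟨hl, hpl⟩
      have h := Finset.card_le_card hsub
      rw [Finset.card_eq_three.2 ⟨x, y, l, hxy, Finset.ne_of_mem_erase hx,
        Finset.ne_of_mem_erase hy, rfl⟩] at h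
      have := harc p
      omega)
    refine ⟨C, ?_, l, hl, hC0, fun m hm hml => hcov m (Finset.mem_erase.2 ⟨hml, hm⟩)⟩
    have := Finset.card_erase_add_one hl
    omega
  push Not at harc
  obtain ⟨p, hp⟩ := harc
  have hsplit := Finset.card_filter_add_card_filter_not (s := U) (fun l => I p l)
  by_cases hb : ∀ r s, ∃ l ∈ U.filter (fun l => ¬ I p l), ¬ I r l ∧ ¬ I s l
  · obtain ⟨C, hC, l, hl, hC0, hcov⟩ := ih _ (by omega) (U.filter (fun l => ¬ I p l)) rfl hb
    rw [mem_filter] at hl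
    refine ⟨insert p C, ?_, l, hl.1, ?_, ?_⟩
    · have := Finset.card_insert_le p C
      omega
    · intro x hx
      rcases Finset.mem_insert.1 hx with rfl | hx
      · exact hl.2
      · exact hC0 x hx
    · intro m hm hml
      by_cases hpm : I p m
      · exact ⟨p, by simp, hpm⟩
      · obtain ⟨x, hx, hxm⟩ := hcov m (mem_filter.2 ⟨hm, hpm⟩) hml
        exact ⟨x, Finset.mem_insert_of_mem hx, hxm⟩
  push Not at hb
  obtain ⟨r, s, hrs⟩ := hb
  have hcov : ∀ l ∈ U, I p l ∨ I r l ∨ I s l := by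
    intro l hl
    have := hrs l
    rw [mem_filter] at this
    tauto
  have hsum : (U.filter (fun l => I p l ∧ ¬ I r l ∧ ¬ I s l)).card
      + (U.filter (fun l => I r l ∧ ¬ I s l ∧ ¬ I p l)).card
      + (U.filter (fun l => I s l ∧ ¬ I p l ∧ ¬ I r l)).card ≤ U.card := by
    rw [← Finset.card_union_of_disjoint, ← Finset.card_union_of_disjoint]
    · apply Finset.card_le_card
      intro x hx
      simp only [mem_union, mem_filter] at hx
      tauto
    · rw [Finset.disjoint_left]
      intro x hx hx'
      simp only [mem_union, mem_filter] at hx hx'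
      tauto
    · rw [Finset.disjoint_left]
      intro x hx hx'
      simp only [mem_filter] at hx hx'
      tauto
  by_cases ha : 3 * (U.filter (fun l => I p l ∧ ¬ I r l ∧ ¬ I s l)).card ≤ U.card
  · exact nb_three I n hn hoff U hU p r s hcov ha
  by_cases hb : 3 * (U.filter (fun l => I r l ∧ ¬ I s l ∧ ¬ I p l)).card ≤ U.card
  · exact nb_three I n hn hoff U hU r s p (fun l hl => by have := hcov l hl; tauto) hb
  · exact nb_three I n hn hoff U hU s p r (fun l hl => by have := hcov l hl; tauto) (by omega)

end Abstract

theorem nb_incid_iff {F : Type*} [Field F] (p l : PG F) :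
    Incid p l ↔ Projectivization.orthogonal p l := by
  conv_rhs => rw [← p.mk_rep, ← l.mk_rep, Projectivization.orthogonal_mk]
  rfl

/-- If `q ≥ 5` is odd and `𝒰` is a nonempty set of lines which cannot be
blocked by a set of at most `2` points, then `𝒰` has a near-blocker of size at
most `|𝒰|/3 + (q + 1)/6`: a set `C` of points such that exactly one line of
`𝒰` is disjoint from `C` (and `C` meets every other line of `𝒰`). -/
theorem stmt18 {F : Type*} [Field F] [Fintype F] (q : ℕ)
    (hcard : Fintype.card F = q) (hq : Odd q) (h5 : 5 ≤ q)
    (U : Set (PG F)) (hne : U.Nonempty)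
    (hblock : ¬ ∃ V : Set (PG F), V.ncard ≤ 2 ∧ ∀ l ∈ U, ∃ p ∈ V, Incid p l) :
    ∃ C : Set (PG F),
      (C.ncard : ℝ) ≤ (U.ncard : ℝ) / 3 + ((q : ℝ) + 1) / 6 ∧
      ∃! l : PG F, l ∈ U ∧ ∀ p ∈ C, ¬ Incid p l := by
  classical
  have : Fintype (PG F) := Fintype.ofFinite _
  have hcp : Fintype.card (PG F) = q ^ 2 + q + 1 := by
    rw [← Nat.card_eq_fintype_card, Projectivization.card_of_finrank F (Fin 3 → F) (n := 3) (by simp)]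
    simp [Finset.sum_range_succ, hcard]
    ring
  have hord : Configuration.ProjectivePlane.order (PG F) (PG F) = q := by
    have h := Configuration.ProjectivePlane.card_points (PG F) (PG F)
    rw [hcp] at h
    nlinarith
  have hpc : ∀ l : PG F, (Finset.univ.filter (fun p => Incid p l)).card = q + 1 := by
    intro l
    have h := Configuration.ProjectivePlane.pointCount_eq (PG F) l
    rw [hord, Configuration.pointCount, Nat.card_eq_fintype_card, Fintype.card_subtype] at h
    rw [← h]
    congr 1
    ext p
    simp only [Finset.mem_filter, nb_incid_iff, Configuration.ofField.mem_iff]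
  obtain ⟨l0, -⟩ := hne
  obtain ⟨C, hC, l, hl, hC0, hcov⟩ := nb_main (fun p l : PG F => Incid p l) q hq h5 l0
    (by
      intro l m hlm
      have h := Configuration.HasPoints.mkPoint_ax (P := PG F) hlm
      simp only [nb_incid_iff]
      exact ⟨_, h⟩)
    (by
      intro p r l m
      simp only [nb_incid_iff]
      exact Configuration.ofField.eq_or_eq_of_orthogonal)
    hpc (by rw [hcp]; nlinarith) _ U.toFinset rfl (by
      intro p r
      by_contra hc
      push Not at hc
      refine hblock ⟨{p, r}, (Set.ncard_insert_le _ _).trans (by simp), fun l hl => ?_⟩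
      have := hc l (by simpa using hl)
      by_cases hp : Incid p l
      · exact ⟨p, by simp, hp⟩
      · exact ⟨r, by simp, this hp⟩)
  refine ⟨C, ?_, l, ⟨by simpa using hl, fun p hp => hC0 p (by simpa using hp)⟩, ?_⟩
  · rw [Set.ncard_coe_finset, Set.ncard_eq_toFinset_card']
    have : (6 * C.card : ℝ) ≤ 2 * U.toFinset.card + q + 1 := by exact_mod_cast hC
    linarith
  · rintro m ⟨hm, hm'⟩
    by_contra hml
    obtain ⟨x, hx, hxm⟩ := hcov m (by simpa using hm) hml
    exact hm' x (by simpa using hx) hxm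
end
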